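/- For all smooth f, h : ℝ → ℝ, the Lie bracket of the vector fields T(f) and X(h) on ℝ⁴ satisfies [T(f), X(h)] = X(f·h' − (1/3)f'·h) pointwise. -/

import Mathlib

noncomputable section

/-- The space ℝ⁴, with coordinates (x, y, t, w). -/
abbrev E : Type := ℝ × ℝ × ℝ × ℝ

/-- Lie bracket of vector fields on ℝ⁴:
`[V, W](p) = DW(p)(V(p)) − DV(p)(W(p))`. -/
def lie (V W : E → E) : E → E :=
  fun p => fderiv ℝ W p (V p) - fderiv ℝ V p (W p)

/-- The Virasoro vector field `T(f)`. -/
def Tf (f : ℝ → ℝ) : E → E := fun p =>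
  ((1/3) * p.1 * deriv f p.2.2.1 + (2/9) * p.2.1 ^ 2 * deriv (deriv f) p.2.2.1,
   (2/3) * p.2.1 * deriv f p.2.2.1,
   f p.2.2.1,
   -((1/3) * p.2.2.2 * deriv f p.2.2.1 + (1/9) * p.1 ^ 2 * deriv (deriv f) p.2.2.1
     + (4/27) * p.1 * p.2.1 ^ 2 * deriv (deriv (deriv f)) p.2.2.1
     + (4/243) * p.2.1 ^ 4 * deriv (deriv (deriv (deriv f))) p.2.2.1))

/-- The Kac–Moody vector field `Y(g)`. -/
def Yf (g : ℝ → ℝ) : E → E := fun p =>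
  ((2/3) * p.2.1 * deriv g p.2.2.1,
   g p.2.2.1,
   0,
   -((4/9) * p.1 * p.2.1 * deriv (deriv g) p.2.2.1
     + (8/81) * p.2.1 ^ 3 * deriv (deriv (deriv g)) p.2.2.1))

/-- The Kac–Moody vector field `X(h)`. -/
def Xf (h : ℝ → ℝ) : E → E := fun p =>
  (h p.2.2.1, 0, 0, -((2/3) * p.1 * deriv h p.2.2.1 + (4/9) * p.2.1 ^ 2 * deriv (deriv h) p.2.2.1))

/-- The Kac–Moody vector field `W(k)`. -/
def Wf (k : ℝ → ℝ) : E → E := fun p =>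
  (0, 0, 0, p.2.1 * k p.2.2.1)

/-- The Kac–Moody vector field `U(ℓ)`. -/
def Uf (l : ℝ → ℝ) : E → E := fun p =>
  (0, 0, 0, l p.2.2.1)

theorem ContDiff.hasDerivAt_of_top {f : ℝ → ℝ} (hf : ContDiff ℝ (⊤ : ℕ∞) f) (t : ℝ) :
    HasDerivAt f (deriv f t) t :=
  (hf.differentiable (by simp)).differentiableAt.hasDerivAt

theorem ContDiff.deriv_of_top {f : ℝ → ℝ} (hf : ContDiff ℝ (⊤ : ℕ∞) f) :
    ContDiff ℝ (⊤ : ℕ∞) (deriv f) :=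
  (contDiff_infty_iff_deriv.mp hf).2

/-- The coordinate `x` on ℝ⁴ as a continuous linear map. -/
abbrev coordX : E →L[ℝ] ℝ := ContinuousLinearMap.fst ℝ ℝ (ℝ × ℝ × ℝ)

/-- The coordinate `y` on ℝ⁴ as a continuous linear map. -/
abbrev coordY : E →L[ℝ] ℝ :=
  (ContinuousLinearMap.fst ℝ ℝ (ℝ × ℝ)).comp (ContinuousLinearMap.snd ℝ ℝ (ℝ × ℝ × ℝ))

/-- The coordinate `t` on ℝ⁴ as a continuous linear map. -/
abbrev coordT : E →L[ℝ] ℝ :=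
  (ContinuousLinearMap.fst ℝ ℝ ℝ).comp
    ((ContinuousLinearMap.snd ℝ ℝ (ℝ × ℝ)).comp (ContinuousLinearMap.snd ℝ ℝ (ℝ × ℝ × ℝ)))

/-- The coordinate `w` on ℝ⁴ as a continuous linear map. -/
abbrev coordW : E →L[ℝ] ℝ :=
  (ContinuousLinearMap.snd ℝ ℝ ℝ).comp
    ((ContinuousLinearMap.snd ℝ ℝ (ℝ × ℝ)).comp (ContinuousLinearMap.snd ℝ ℝ (ℝ × ℝ × ℝ)))

theorem hasFDerivAt_comp_coordT {f : ℝ → ℝ} (hf : ContDiff ℝ (⊤ : ℕ∞) f) (p : E) :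
    HasFDerivAt (fun q : E => f q.2.2.1) (deriv f p.2.2.1 • coordT) p :=
  HasDerivAt.comp_hasFDerivAt (f := fun q : E => q.2.2.1) p
    (hf.hasDerivAt_of_top p.2.2.1) coordT.hasFDerivAt

theorem fderiv_Xf {h : ℝ → ℝ} (hh : ContDiff ℝ (⊤ : ℕ∞) h) (p v : E) :
    fderiv ℝ (Xf h) p v =
      (deriv h p.2.2.1 * v.2.2.1, 0, 0,
       -((2/3) * v.1 * deriv h p.2.2.1 + (2/3) * p.1 * deriv (deriv h) p.2.2.1 * v.2.2.1
         + (8/9) * p.2.1 * v.2.1 * deriv (deriv h) p.2.2.1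
         + (4/9) * p.2.1 ^ 2 * deriv (deriv (deriv h)) p.2.2.1 * v.2.2.1)) := by
  have hx : HasFDerivAt (fun q : E => q.1) coordX p := coordX.hasFDerivAt
  have hy : HasFDerivAt (fun q : E => q.2.1) coordY p := coordY.hasFDerivAt
  have h0 := hasFDerivAt_comp_coordT hh p
  have h1 := hasFDerivAt_comp_coordT hh.deriv_of_top p
  have h2 := hasFDerivAt_comp_coordT hh.deriv_of_top.deriv_of_top p
  have key := h0.prodMk ((hasFDerivAt_const (0 : ℝ) p).prodMk ((hasFDerivAt_const (0 : ℝ) p).prodMk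
    (((hx.const_mul (2/3)).mul h1).add (((hy.pow 2).const_mul (4/9)).mul h2)).neg))
  refine (DFunLike.congr_fun key.fderiv v).trans ?_
  ext <;> simp
  ring

theorem fderiv_Tf {f : ℝ → ℝ} (hf : ContDiff ℝ (⊤ : ℕ∞) f) (p v : E) :
    fderiv ℝ (Tf f) p v =
      ((1/3) * v.1 * deriv f p.2.2.1 + (1/3) * p.1 * deriv (deriv f) p.2.2.1 * v.2.2.1
         + (4/9) * p.2.1 * v.2.1 * deriv (deriv f) p.2.2.1
         + (2/9) * p.2.1 ^ 2 * deriv (deriv (deriv f)) p.2.2.1 * v.2.2.1,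
       (2/3) * v.2.1 * deriv f p.2.2.1 + (2/3) * p.2.1 * deriv (deriv f) p.2.2.1 * v.2.2.1,
       deriv f p.2.2.1 * v.2.2.1,
       -((1/3) * v.2.2.2 * deriv f p.2.2.1
         + (1/3) * p.2.2.2 * deriv (deriv f) p.2.2.1 * v.2.2.1
         + (2/9) * p.1 * v.1 * deriv (deriv f) p.2.2.1
         + (1/9) * p.1 ^ 2 * deriv (deriv (deriv f)) p.2.2.1 * v.2.2.1
         + (4/27) * v.1 * p.2.1 ^ 2 * deriv (deriv (deriv f)) p.2.2.1
         + (8/27) * p.1 * p.2.1 * v.2.1 * deriv (deriv (deriv f)) p.2.2.1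
         + (4/27) * p.1 * p.2.1 ^ 2 * deriv (deriv (deriv (deriv f))) p.2.2.1 * v.2.2.1
         + (16/243) * p.2.1 ^ 3 * v.2.1 * deriv (deriv (deriv (deriv f))) p.2.2.1
         + (4/243) * p.2.1 ^ 4 * deriv (deriv (deriv (deriv (deriv f)))) p.2.2.1 * v.2.2.1)) := by
  have hx : HasFDerivAt (fun q : E => q.1) coordX p := coordX.hasFDerivAt
  have hy : HasFDerivAt (fun q : E => q.2.1) coordY p := coordY.hasFDerivAt
  have hw : HasFDerivAt (fun q : E => q.2.2.2) coordW p := coordW.hasFDerivAt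
  have h0 := hasFDerivAt_comp_coordT hf p
  have h1 := hasFDerivAt_comp_coordT hf.deriv_of_top p
  have h2 := hasFDerivAt_comp_coordT hf.deriv_of_top.deriv_of_top p
  have h3 := hasFDerivAt_comp_coordT hf.deriv_of_top.deriv_of_top.deriv_of_top p
  have h4 := hasFDerivAt_comp_coordT hf.deriv_of_top.deriv_of_top.deriv_of_top.deriv_of_top p
  have key := (((hx.const_mul (1/3)).mul h1).add (((hy.pow 2).const_mul (2/9)).mul h2)).prodMk
    (((hy.const_mul (2/3)).mul h1).prodMk (h0.prodMk
      (((((hw.const_mul (1/3)).mul h1).add (((hx.pow 2).const_mul (1/9)).mul h2)).add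
        (((hx.const_mul (4/27)).mul (hy.pow 2)).mul h3)).add
        (((hy.pow 4).const_mul (4/243)).mul h4)).neg))
  refine (DFunLike.congr_fun key.fderiv v).trans ?_
  ext <;> simp <;> ring

theorem deriv_mul_deriv_sub {f h : ℝ → ℝ} (hf : ContDiff ℝ (⊤ : ℕ∞) f)
    (hh : ContDiff ℝ (⊤ : ℕ∞) h) :
    deriv (fun t => f t * deriv h t - (1/3) * deriv f t * h t) =
      fun t => f t * deriv (deriv h) t + (2/3) * deriv f t * deriv h t
        - (1/3) * deriv (deriv f) t * h t := by
  funext t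
  have hf0 := hf.hasDerivAt_of_top t
  have hf1 := hf.deriv_of_top.hasDerivAt_of_top t
  have hh0 := hh.hasDerivAt_of_top t
  have hh1 := hh.deriv_of_top.hasDerivAt_of_top t
  refine (((hf0.mul hh1).sub ((hf1.const_mul (1/3)).mul hh0)).congr_deriv ?_).deriv
  ring

theorem deriv_deriv_mul_deriv_sub {f h : ℝ → ℝ} (hf : ContDiff ℝ (⊤ : ℕ∞) f)
    (hh : ContDiff ℝ (⊤ : ℕ∞) h) :
    deriv (deriv (fun t => f t * deriv h t - (1/3) * deriv f t * h t)) =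
      fun t => f t * deriv (deriv (deriv h)) t + (5/3) * deriv f t * deriv (deriv h) t
        + (1/3) * deriv (deriv f) t * deriv h t - (1/3) * deriv (deriv (deriv f)) t * h t := by
  rw [deriv_mul_deriv_sub hf hh]
  funext t
  have hf0 := hf.hasDerivAt_of_top t
  have hf1 := hf.deriv_of_top.hasDerivAt_of_top t
  have hf2 := hf.deriv_of_top.deriv_of_top.hasDerivAt_of_top t
  have hh0 := hh.hasDerivAt_of_top t
  have hh1 := hh.deriv_of_top.hasDerivAt_of_top t
  have hh2 := hh.deriv_of_top.deriv_of_top.hasDerivAt_of_top t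
  refine ((((hf0.mul hh2).add ((hf1.const_mul (2/3)).mul hh1)).sub
    ((hf2.const_mul (1/3)).mul hh0)).congr_deriv ?_).deriv
  ring

/-- `[T(f), X(h)] = X(f·h' − (1/3)f'·h)`. -/
theorem stmt11 (f h : ℝ → ℝ) (hf : ContDiff ℝ (⊤ : ℕ∞) f) (hh : ContDiff ℝ (⊤ : ℕ∞) h) :
    ∀ p : E, lie (Tf f) (Xf h) p
      = Xf (fun t => f t * deriv h t - (1/3) * deriv f t * h t) p := by
  intro p
  rw [lie, fderiv_Xf hh, fderiv_Tf hf]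
  simp only [Xf]
  rw [deriv_deriv_mul_deriv_sub hf hh, deriv_mul_deriv_sub hf hh]
  ext <;> simp [Tf] <;> ring
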